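/- On ℝ⁵ with coordinates (x,t,a,b,c), the vector fields X₃(x,t,a,b,c) = (x,0,0,−2b,−c), X₄(x,t,a,b,c) = (0,x,0,2c,a), X₅(x,t,a,b,c) = (t,0,2c,0,b), X₆(x,t,a,b,c) = (0,t,0,2b,c) satisfy the Lie bracket relations [X₃, X₄] = X₄, [X₃, X₅] = −X₅, [X₄, X₆] = X₄, [X₅, X₆] = −X₅, and [X₃, X₆] = 0. -/

import Mathlib

/-- `ℝ⁵` with coordinates `(x, t, a, b, c)`. -/
abbrev V5 := ℝ × ℝ × ℝ × ℝ × ℝ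

/-- Lie bracket of vector fields on `ℝ⁵`:
`[V, W](p) = DW(p)(V(p)) − DV(p)(W(p))`. -/
noncomputable def lieBracketVF (V W : V5 → V5) : V5 → V5 :=
  fun p => fderiv ℝ W p (V p) - fderiv ℝ V p (W p)

def X1 : V5 → V5 := fun _ => (1, 0, 0, 0, 0)
def X2 : V5 → V5 := fun _ => (0, 1, 0, 0, 0)
def X3 : V5 → V5 := fun p => (p.1, 0, 0, -2 * p.2.2.2.1, -p.2.2.2.2)
def X4 : V5 → V5 := fun p => (0, p.1, 0, 2 * p.2.2.2.2, p.2.2.1)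
def X5 : V5 → V5 := fun p => (p.2.1, 0, 2 * p.2.2.2.2, 0, p.2.2.2.1)
def X6 : V5 → V5 := fun p => (0, p.2.1, 0, 2 * p.2.2.2.1, p.2.2.2.2)
def X7 : V5 → V5 := fun p => (0, 0, p.2.2.1, p.2.2.2.1, p.2.2.2.2)

theorem fderiv_apply_of_isLinearMap {V : V5 → V5} (hV : IsLinearMap ℝ V) (p v : V5) :
    fderiv ℝ V p v = V v :=
  congrArg (fun L : V5 →L[ℝ] V5 => L v)
    (LinearMap.toContinuousLinearMap (hV.mk' V)).hasFDerivAt.fderiv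

theorem lieBracketVF_of_isLinearMap {V W : V5 → V5} (hV : IsLinearMap ℝ V)
    (hW : IsLinearMap ℝ W) : lieBracketVF V W = fun p => W (V p) - V (W p) := by
  funext p
  simp only [lieBracketVF, fderiv_apply_of_isLinearMap hV, fderiv_apply_of_isLinearMap hW]

theorem isLinearMap_X3 : IsLinearMap ℝ X3 := by
  constructor <;> intros <;> simp [X3] <;> (try constructor) <;> ring

theorem isLinearMap_X4 : IsLinearMap ℝ X4 := by
  constructor <;> intros <;> simp [X4] <;> ring

theorem isLinearMap_X5 : IsLinearMap ℝ X5 := by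
  constructor <;> intros <;> simp [X5] <;> ring

theorem isLinearMap_X6 : IsLinearMap ℝ X6 := by
  constructor <;> intros <;> simp [X6] <;> ring

/-- Commutator relations among `X₃, X₄, X₅, X₆`. -/
theorem brackets_X3_X4_X5_X6 :
    lieBracketVF X3 X4 = X4 ∧ lieBracketVF X3 X5 = -X5 ∧
    lieBracketVF X4 X6 = X4 ∧ lieBracketVF X5 X6 = -X5 ∧
    lieBracketVF X3 X6 = 0 := by
  rw [lieBracketVF_of_isLinearMap isLinearMap_X3 isLinearMap_X4,
    lieBracketVF_of_isLinearMap isLinearMap_X3 isLinearMap_X5,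
    lieBracketVF_of_isLinearMap isLinearMap_X4 isLinearMap_X6,
    lieBracketVF_of_isLinearMap isLinearMap_X5 isLinearMap_X6,
    lieBracketVF_of_isLinearMap isLinearMap_X3 isLinearMap_X6]
  refine ⟨?_, ?_, ?_, ?_, ?_⟩ <;> funext p <;> ext <;> simp [X3, X4, X5, X6] <;> ring
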